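/- Let A be a semiabelian category and let α : D → D, β : D → E, γ : E → D be an exact couple in which α, β and γ are strict, and perform both the left and the right Eckmann–Hilton constructions. Then there exists a unique morphism ω : E₁⁻ → E₁⁺ satisfying ρ″∘ω∘σ′ = σ″∘ρ′; this ω is both a monomorphism and an epimorphism and satisfies ω∘β₁⁻ = β₁⁺ and γ₁⁺∘ω = γ₁⁻. -/

import Mathlib

open CategoryTheory CategoryTheory.Limits

universe v u

variable {C : Type u} [Category.{v} C] [Preadditive C] [HasFiniteBiproducts C]
  [HasKernels C] [HasCokernels C]

/-- `ι` is a kernel of `g`, i.e. `ι ≫ g = 0` and `ι` is a limit kernel fork of `g`. -/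
def IsKernelOf {X Y Z : C} (ι : X ⟶ Y) (g : Y ⟶ Z) : Prop :=
  ∃ w : ι ≫ g = 0, Nonempty (IsLimit (KernelFork.ofι ι w))

/-- `π` is a cokernel of `g`, i.e. `g ≫ π = 0` and `π` is a colimit cokernel cofork of `g`. -/
def IsCokernelOf {X Y Q : C} (g : X ⟶ Y) (π : Y ⟶ Q) : Prop :=
  ∃ w : g ≫ π = 0, Nonempty (IsColimit (CokernelCofork.ofπ π w))

/-- A morphism is *a kernel* if it is a kernel of some morphism (a normal monomorphism). -/
def IsAKernel {X Y : C} (ι : X ⟶ Y) : Prop :=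
  ∃ (Z : C) (g : Y ⟶ Z), IsKernelOf ι g

/-- A morphism is *a cokernel* if it is a cokernel of some morphism (a normal epimorphism). -/
def IsACokernel {Y Q : C} (π : Y ⟶ Q) : Prop :=
  ∃ (X : C) (g : X ⟶ Y), IsCokernelOf g π

/-- A kernel `ι` is semistable if every pushout of `ι` along an arbitrary morphism
is again a kernel. -/
def SemistableKernel {X Y : C} (ι : X ⟶ Y) : Prop :=
  IsAKernel ι ∧ ∀ {Z P : C} (s : X ⟶ Z) (t : Y ⟶ P) (y : Z ⟶ P),
    IsPushout ι s t y → IsAKernel y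

/-- A cokernel `π` is semistable if every pullback of `π` along an arbitrary morphism
is again a cokernel. -/
def SemistableCokernel {Y Q : C} (π : Y ⟶ Q) : Prop :=
  IsACokernel π ∧ ∀ {P Z : C} (t : P ⟶ Y) (y : P ⟶ Z) (s : Z ⟶ Q),
    IsPullback t y π s → IsACokernel y

theorem IsKernelOf.zero {X Y Z : C} {i : X ⟶ Y} {g : Y ⟶ Z} (h : IsKernelOf i g) :
    i ≫ g = 0 := h.1

theorem IsKernelOf.mono {X Y Z : C} {i : X ⟶ Y} {g : Y ⟶ Z} (h : IsKernelOf i g) : Mono i := by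
  obtain ⟨w, ⟨h⟩⟩ := h
  exact mono_of_isLimit_fork h

theorem IsKernelOf.exists_lift {X Y Z T : C} {i : X ⟶ Y} {g : Y ⟶ Z} (h : IsKernelOf i g)
    (t : T ⟶ Y) (ht : t ≫ g = 0) : ∃ s : T ⟶ X, s ≫ i = t := by
  obtain ⟨w, ⟨h⟩⟩ := h
  obtain ⟨s, hs⟩ := KernelFork.IsLimit.lift' h t ht
  exact ⟨s, hs⟩

theorem IsCokernelOf.zero {X Y Z : C} {g : X ⟶ Y} {p : Y ⟶ Z} (h : IsCokernelOf g p) :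
    g ≫ p = 0 := h.1

theorem IsCokernelOf.epi {X Y Z : C} {g : X ⟶ Y} {p : Y ⟶ Z} (h : IsCokernelOf g p) : Epi p := by
  obtain ⟨w, ⟨h⟩⟩ := h
  exact epi_of_isColimit_cofork h

theorem IsCokernelOf.exists_desc {X Y Z T : C} {g : X ⟶ Y} {p : Y ⟶ Z} (h : IsCokernelOf g p)
    (t : Y ⟶ T) (ht : g ≫ t = 0) : ∃ s : Z ⟶ T, p ≫ s = t := by
  obtain ⟨w, ⟨h⟩⟩ := h
  obtain ⟨s, hs⟩ := CokernelCofork.IsColimit.desc' h t ht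
  exact ⟨s, hs⟩

/-- If `p` is a coimage and `i` an image of `f`, and `p ≫ w ≫ i = f`, then `w` is a bimorphism. -/
theorem bimorphism_of_image_coimage {K Q A B : C} (f : K ⟶ Q) (p : K ⟶ A) (i : B ⟶ Q) (w : A ⟶ B)
    (hm : Mono (Abelian.coimageImageComparison f)) (he : Epi (Abelian.coimageImageComparison f))
    [Epi p] [Mono i]
    (hp : kernel.ι f ≫ p = 0) (hi : i ≫ cokernel.π f = 0)
    (hp' : ∃ s : A ⟶ Abelian.coimage f, p ≫ s = Abelian.coimage.π f)
    (hi' : ∃ s : Abelian.image f ⟶ B, s ≫ i = Abelian.image.ι f)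
    (hw : p ≫ w ≫ i = f) : Mono w ∧ Epi w := by
  obtain ⟨s, hs⟩ := hp'
  obtain ⟨r, hr⟩ := hi'
  have key : w = s ≫ Abelian.coimageImageComparison f ≫ r := by
    rw [← cancel_mono i, ← cancel_epi p, hw]
    simp only [Category.assoc, hr]
    rw [reassoc_of% hs, Abelian.coimage_image_factorisation]
  let u : Abelian.coimage f ⟶ A := cokernel.desc _ p hp
  have hu : Abelian.coimage.π f ≫ u = p := cokernel.π_desc _ _ _
  let z : B ⟶ Abelian.image f := kernel.lift _ i hi
  have hz : z ≫ Abelian.image.ι f = i := kernel.lift_ι _ _ _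
  have : IsIso s := ⟨u, by rw [← cancel_epi p, reassoc_of% hs, hu, Category.comp_id],
    by rw [← cancel_epi (Abelian.coimage.π f), reassoc_of% hu, hs, Category.comp_id]⟩
  have : IsIso r := ⟨z, by rw [← cancel_mono (Abelian.image.ι f), Category.assoc, hz, hr,
      Category.id_comp],
    by rw [← cancel_mono i, Category.assoc, hr, hz, Category.id_comp]⟩
  subst key
  exact ⟨inferInstance, inferInstance⟩

/-- There is a unique morphism ω : E₁⁻ ⟶ E₁⁺ with ρ″∘ω∘σ′ = σ″∘ρ′;
it is a bimorphism and satisfies ω∘β₁⁻ = β₁⁺ and γ₁⁺∘ω = γ₁⁻. -/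
theorem canonical_bimorphism_between_derived_couples
    (hsemi : ∀ {X Y : C} (f : X ⟶ Y),
      Mono (Abelian.coimageImageComparison f) ∧ Epi (Abelian.coimageImageComparison f))
    -- the exact couple, with all three morphisms strict
    {D E D₁ Eρ E₁m : C} (α : D ⟶ D) (β : D ⟶ E) (γ : E ⟶ D)
    (hc1 : IsKernelOf (Abelian.image.ι α) β)
    (hc2 : IsKernelOf (Abelian.image.ι β) γ)
    (hc3 : IsKernelOf (Abelian.image.ι γ) α)
    (hsα : IsIso (Abelian.coimageImageComparison α))
    (hsβ : IsIso (Abelian.coimageImageComparison β))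
    (hsγ : IsIso (Abelian.coimageImageComparison γ))
    -- the strict factorization α = ρ ∘ σ with σ = cok γ and ρ = ker β
    (σ : D ⟶ D₁) (ρ : D₁ ⟶ D)
    (hσ : IsCokernelOf γ σ) (hρ : IsKernelOf ρ β) (hα : σ ≫ ρ = α)
    -- left construction: pullback of γ along ρ
    (ρ' : Eρ ⟶ E) (γ' : Eρ ⟶ D₁) (hPB : IsPullback ρ' γ' γ ρ)
    (β' : D ⟶ Eρ) (hβ' : β' ≫ ρ' = β) (hβ'0 : β' ≫ γ' = 0)
    -- left construction: pushout of β' along σ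
    (σ' : Eρ ⟶ E₁m) (β₁m : D₁ ⟶ E₁m) (hPO : IsPushout β' σ σ' β₁m)
    (γ₁m : E₁m ⟶ D₁) (hγ₁ : σ' ≫ γ₁m = γ') (hγ₁0 : β₁m ≫ γ₁m = 0)
    -- right construction: pushout of β along σ
    {Eσ E₁p : C} (σ'' : E ⟶ Eσ) (β'' : D₁ ⟶ Eσ) (hPO' : IsPushout β σ σ'' β'')
    (γ'' : Eσ ⟶ D) (hγ'' : σ'' ≫ γ'' = γ) (hγ''0 : β'' ≫ γ'' = 0)
    -- right construction: pullback of γ'' along ρ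
    (ρ'' : E₁p ⟶ Eσ) (γ₁p : E₁p ⟶ D₁) (hPB' : IsPullback ρ'' γ₁p γ'' ρ)
    (β₁p : D₁ ⟶ E₁p) (hβ₁p : β₁p ≫ ρ'' = β'') (hβ₁p0 : β₁p ≫ γ₁p = 0)
    :
    (∃! ω : E₁m ⟶ E₁p, σ' ≫ ω ≫ ρ'' = ρ' ≫ σ'') ∧
    ∀ ω : E₁m ⟶ E₁p, σ' ≫ ω ≫ ρ'' = ρ' ≫ σ'' →
      Mono ω ∧ Epi ω ∧ β₁m ≫ ω = β₁p ∧ ω ≫ γ₁p = γ₁m := by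
  have hσe := hσ.epi
  have hρm := hρ.mono
  have hρβ := hρ.zero
  have hγσ := hσ.zero
  have hσ'e : Epi σ' := by
    constructor
    intro Z a b h
    refine hPO.hom_ext h ?_
    rw [← cancel_epi σ, ← Category.assoc, ← Category.assoc, ← hPO.w, Category.assoc,
      Category.assoc, h]
  have hσ''e : Epi σ'' := by
    constructor
    intro Z a b h
    refine hPO'.hom_ext h ?_
    rw [← cancel_epi σ, ← Category.assoc, ← Category.assoc, ← hPO'.w, Category.assoc,
      Category.assoc, h]
  have hρ'm : Mono ρ' := by
    constructor
    intro Z a b h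
    refine hPB.hom_ext h ?_
    rw [← cancel_mono ρ, Category.assoc, Category.assoc, ← hPB.w, reassoc_of% h]
  have hρ''m : Mono ρ'' := by
    constructor
    intro Z a b h
    refine hPB'.hom_ext h ?_
    rw [← cancel_mono ρ, Category.assoc, Category.assoc, ← hPB'.w, reassoc_of% h]
  -- existence
  obtain ⟨ω₀, h1, h2, h3⟩ : ∃ ω : E₁m ⟶ E₁p, σ' ≫ ω ≫ ρ'' = ρ' ≫ σ'' ∧ β₁m ≫ ω = β₁p ∧
      ω ≫ γ₁p = γ₁m := by
    have w1 : β' ≫ ρ' ≫ σ'' = σ ≫ β'' := by rw [reassoc_of% hβ', hPO'.w]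
    let θ := hPO.desc (ρ' ≫ σ'') β'' w1
    have t1 : σ' ≫ θ = ρ' ≫ σ'' := hPO.inl_desc _ _ _
    have t2 : β₁m ≫ θ = β'' := hPO.inr_desc _ _ _
    have w2 : θ ≫ γ'' = γ₁m ≫ ρ := by
      refine hPO.hom_ext ?_ ?_
      · rw [reassoc_of% t1, hγ'', reassoc_of% hγ₁, hPB.w]
      · rw [reassoc_of% t2, hγ''0, reassoc_of% hγ₁0, zero_comp]
    let ω := hPB'.lift θ γ₁m w2
    have o1 : ω ≫ ρ'' = θ := hPB'.lift_fst _ _ _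
    have o2 : ω ≫ γ₁p = γ₁m := hPB'.lift_snd _ _ _
    refine ⟨ω, by rw [o1, t1], ?_, o2⟩
    refine hPB'.hom_ext ?_ ?_
    · rw [Category.assoc, o1, t2, hβ₁p]
    · rw [Category.assoc, o2, hγ₁0, hβ₁p0]
  have huniq : ∀ ω : E₁m ⟶ E₁p, σ' ≫ ω ≫ ρ'' = ρ' ≫ σ'' → ω = ω₀ := by
    intro ω h
    rw [← cancel_mono ρ'', ← cancel_epi σ', h, h1]
  refine ⟨⟨ω₀, h1, huniq⟩, ?_⟩
  intro ω h
  obtain rfl := huniq ω h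
  suffices hh : Mono ω ∧ Epi ω from ⟨hh.1, hh.2, h2, h3⟩
  -- the differential
  obtain ⟨d, hd⟩ : ∃ d : E ⟶ E, d = γ ≫ β := ⟨_, rfl⟩
  have hβγ : β ≫ γ = 0 := by
    rw [← hβ', Category.assoc, hPB.w, reassoc_of% hβ'0, zero_comp]
  have hdd : d ≫ d = 0 := by
    rw [hd, Category.assoc, reassoc_of% hβγ, zero_comp, comp_zero]
  have hdσ'' : d ≫ σ'' = 0 := by
    rw [hd, Category.assoc, hPO'.w, reassoc_of% hγσ, zero_comp]
  have hρ'd : ρ' ≫ d = 0 := by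
    rw [hd, reassoc_of% hPB.w, hρβ, comp_zero]
  have := (hsemi d).1
  have := (hsemi d).2
  have hfac := Abelian.coimage_image_factorisation d
  let e : E ⟶ Abelian.image d := Abelian.coimage.π d ≫ Abelian.coimageImageComparison d
  let n : Abelian.coimage d ⟶ E := Abelian.coimageImageComparison d ≫ Abelian.image.ι d
  have hee : Epi e := epi_comp _ _
  have hnm : Mono n := mono_comp _ _
  have he : e ≫ Abelian.image.ι d = d := by simp only [e, Category.assoc, hfac]
  have hn : Abelian.coimage.π d ≫ n = d := hfac
  clear_value e n
  refine bimorphism_of_image_coimage (ρ' ≫ σ'') σ' ρ'' ω (hsemi _).1 (hsemi _).2 ?_ ?_ ?_ ?_ h1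
  · -- the kernel of `ρ' ≫ σ''` is killed by `σ'`
    have hid : Abelian.image.ι d ≫ d = 0 := by
      rw [← cancel_epi e, reassoc_of% he, hdd, comp_zero]
    obtain ⟨s, hs⟩ := hρ.exists_lift (Abelian.image.ι d ≫ γ) (by rw [Category.assoc, ← hd, hid])
    let l := hPB.lift (Abelian.image.ι d) s hs.symm
    have hl : l ≫ ρ' = Abelian.image.ι d := hPB.lift_fst _ _ _
    have hel : e ≫ l = γ ≫ β' := by
      rw [← cancel_mono ρ', Category.assoc, Category.assoc, hl, he, hβ', hd]
    have hlσ : l ≫ σ' = 0 := by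
      rw [← cancel_epi e, reassoc_of% hel, hPO.w, reassoc_of% hγσ, zero_comp, comp_zero]
    -- `cokernel.π d` factors through `σ''`
    obtain ⟨q, hq⟩ := hσ.exists_desc (β ≫ cokernel.π d)
      (by rw [← Category.assoc, ← hd, cokernel.condition])
    let c := hPO'.desc (cokernel.π d) q hq.symm
    have hc : σ'' ≫ c = cokernel.π d := hPO'.inl_desc _ _ _
    have hk : kernel.ι (ρ' ≫ σ'') ≫ ρ' ≫ σ'' = 0 := kernel.condition _
    let m : kernel (ρ' ≫ σ'') ⟶ Abelian.image d :=
      kernel.lift _ (kernel.ι (ρ' ≫ σ'') ≫ ρ')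
        (by rw [← hc, Category.assoc, reassoc_of% hk, zero_comp])
    have hm : m ≫ Abelian.image.ι d = kernel.ι (ρ' ≫ σ'') ≫ ρ' := kernel.lift_ι _ _ _
    have hml : m ≫ l = kernel.ι (ρ' ≫ σ'') := by
      rw [← cancel_mono ρ', Category.assoc, hl, hm]
    rw [← hml, Category.assoc, hlσ, comp_zero]
  · have hid : d ≫ Abelian.coimage.π d = 0 := by
      rw [← cancel_mono n, Category.assoc, hn, hdd, zero_comp]
    obtain ⟨s, hs⟩ := hσ.exists_desc (β ≫ Abelian.coimage.π d)
      (by rw [← Category.assoc, ← hd, hid])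
    let l := hPO'.desc (Abelian.coimage.π d) s hs.symm
    have hl : σ'' ≫ l = Abelian.coimage.π d := hPO'.inl_desc _ _ _
    have hln : l ≫ n = γ'' ≫ β := by
      rw [← cancel_epi σ'', reassoc_of% hl, hn, reassoc_of% hγ'', hd]
    have hlρ : ρ'' ≫ l = 0 := by
      rw [← cancel_mono n, Category.assoc, hln, reassoc_of% hPB'.w, hρβ, comp_zero, zero_comp]
    obtain ⟨q, hq⟩ := hρ.exists_lift (kernel.ι d ≫ γ)
      (by rw [Category.assoc, ← hd, kernel.condition])
    let c := hPB.lift (kernel.ι d) q hq.symm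
    have hc : c ≫ ρ' = kernel.ι d := hPB.lift_fst _ _ _
    have hk : ρ' ≫ σ'' ≫ cokernel.π (ρ' ≫ σ'') = 0 := by
      rw [← Category.assoc, cokernel.condition]
    let m : Abelian.coimage d ⟶ cokernel (ρ' ≫ σ'') :=
      cokernel.desc _ (σ'' ≫ cokernel.π (ρ' ≫ σ''))
        (by rw [← hc, Category.assoc, hk, comp_zero])
    have hm : Abelian.coimage.π d ≫ m = σ'' ≫ cokernel.π (ρ' ≫ σ'') := cokernel.π_desc _ _ _
    have hml : l ≫ m = cokernel.π (ρ' ≫ σ'') := by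
      rw [← cancel_epi σ'', reassoc_of% hl, hm]
    rw [← hml, reassoc_of% hlρ, zero_comp]
  · let g : E ⟶ kernel (ρ' ≫ σ'') := kernel.lift _ (γ ≫ β')
      (by rw [Category.assoc, reassoc_of% hβ', ← Category.assoc, ← hd, hdσ''])
    have hg : g ≫ kernel.ι (ρ' ≫ σ'') = γ ≫ β' := kernel.lift_ι _ _ _
    have hz : kernel.ι (ρ' ≫ σ'') ≫ Abelian.coimage.π (ρ' ≫ σ'') = 0 := cokernel.condition _
    obtain ⟨s, hs⟩ := hσ.exists_desc (β' ≫ Abelian.coimage.π (ρ' ≫ σ''))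
      (by rw [← Category.assoc, ← hg, Category.assoc, hz, comp_zero])
    exact ⟨hPO.desc _ s hs.symm, hPO.inl_desc _ _ _⟩
  · let g : cokernel (ρ' ≫ σ'') ⟶ E := cokernel.desc _ (γ'' ≫ β)
      (by rw [Category.assoc, reassoc_of% hγ'', ← hd, hρ'd])
    have hg : cokernel.π (ρ' ≫ σ'') ≫ g = γ'' ≫ β := cokernel.π_desc _ _ _
    have hz : Abelian.image.ι (ρ' ≫ σ'') ≫ cokernel.π (ρ' ≫ σ'') = 0 := kernel.condition _
    obtain ⟨s, hs⟩ := hρ.exists_lift (Abelian.image.ι (ρ' ≫ σ'') ≫ γ'')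
      (by rw [Category.assoc, ← hg, reassoc_of% hz, zero_comp])
    exact ⟨hPB'.lift _ s hs.symm, hPB'.lift_fst _ _ _⟩
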